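/- Every definite multi-context system has an equilibrium, and it has a unique pointwise-⊆-minimal equilibrium (the grounded equilibrium), which is pointwise contained in every equilibrium of the system. -/

import Mathlib

/-- A bridge rule of a definite MCS: a head literal and a finite positive body. -/
structure Rule (n : ℕ) (α : Type*) where
  head : α
  body : Finset (Fin n × α)
deriving DecidableEq

/-- A definite multi-context system: for each context, a monotone semantic
operator and a finite set of bridge rules. -/
structure MCS (n : ℕ) (α : Type*) [DecidableEq α] where
  ACC : Fin n → Finset α → Finset α
  mono : ∀ i, Monotone (ACC i)
  br : Fin n → Finset (Rule n α)

variable {n : ℕ} {α : Type*} [DecidableEq α]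

/-- A bridge rule is satisfied in a belief state `S` iff every body literal holds. -/
def Satisfied (r : Rule n α) (S : Fin n → Finset α) : Prop :=
  ∀ cp ∈ r.body, cp.2 ∈ S cp.1

instance (r : Rule n α) (S : Fin n → Finset α) : Decidable (Satisfied r S) := by
  unfold Satisfied; infer_instance

/-- The knowledge base induced at context `i` by belief state `S`:
the heads of the bridge rules of context `i` satisfied in `S`. -/
def kbOf (M : MCS n α) (S : Fin n → Finset α) (i : Fin n) : Finset α :=
  ((M.br i).filter (fun r => Satisfied r S)).image Rule.head

/-- A belief state is an equilibrium iff each belief set is the result of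
applying the semantic operator to the induced knowledge base. -/
def IsEquilibrium (M : MCS n α) (S : Fin n → Finset α) : Prop :=
  ∀ i, S i = M.ACC i (kbOf M S i)

/-- The induced knowledge base grows with the belief state. -/
lemma kbOf_mono (M : MCS n α) (i : Fin n) : Monotone fun S => kbOf M S i := by
  intro S T h
  refine Finset.image_subset_image fun r hr => ?_
  rw [Finset.mem_filter] at hr ⊢
  exact ⟨hr.1, fun cp hcp => h cp.1 (hr.2 cp hcp)⟩

/-- The consequence operator of a multi-context system, whose fixed points are its equilibria. -/
def consequence (M : MCS n α) (S : Fin n → Finset α) (i : Fin n) : Finset α :=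
  M.ACC i (kbOf M S i)

lemma consequence_mono (M : MCS n α) : Monotone (consequence M) :=
  fun _ _ h i => M.mono i (kbOf_mono M i h)

lemma consequence_le_of_heads (M : MCS n α) (S : Fin n → Finset α) :
    consequence M S ≤ fun i => M.ACC i ((M.br i).image Rule.head) :=
  fun i => M.mono i (Finset.image_subset_image (Finset.filter_subset _ _))

lemma isEquilibrium_iff_consequence_eq (M : MCS n α) (S : Fin n → Finset α) :
    IsEquilibrium M S ↔ consequence M S = S :=
  ⟨fun h => funext fun i => (h i).symm, fun h i => (congrFun h i).symm⟩

/-- A monotone operator on families of finite sets that has a prefixed point has a fixed point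
below all its prefixed points. -/
lemma exists_fixedPoint_le_prefixed {ι β : Type*} {f : (ι → Finset β) → ι → Finset β}
    (hf : Monotone f) {T : ι → Finset β} (hT : f T ≤ T) :
    ∃ S, f S = S ∧ ∀ P, f P ≤ P → S ≤ P := by
  classical
  let S : ι → Finset β := fun i => (T i).filter fun p => ∀ P, f P ≤ P → p ∈ P i
  have hS : ∀ P, f P ≤ P → S ≤ P := fun P hP i p hp => (Finset.mem_filter.1 hp).2 P hP
  have hle : ∀ P, f P ≤ P → f S ≤ P := fun P hP => (hf (hS P hP)).trans hP
  have hpre : f S ≤ S := fun i p hp =>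
    Finset.mem_filter.2 ⟨hle T hT i hp, fun P hP => hle P hP i hp⟩
  exact ⟨S, le_antisymm hpre (hS _ (hf hpre)), hS⟩

/-- every definite MCS has an equilibrium, and it has a unique
pointwise-⊆-minimal equilibrium (the grounded equilibrium), which is pointwise
contained in every equilibrium. -/
theorem exists_unique_grounded_equilibrium (M : MCS n α) :
    ∃! S : Fin n → Finset α,
      IsEquilibrium M S ∧ ∀ E : Fin n → Finset α, IsEquilibrium M E → ∀ i, S i ⊆ E i := by
  obtain ⟨S, hS, hleast⟩ :=
    exists_fixedPoint_le_prefixed (consequence_mono M) (consequence_le_of_heads M _)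
  have hE : IsEquilibrium M S := (isEquilibrium_iff_consequence_eq M S).2 hS
  refine ⟨S, ⟨hE, fun E h => hleast E ((isEquilibrium_iff_consequence_eq M E).1 h).le⟩, ?_⟩
  rintro S' ⟨hS', hle⟩
  exact le_antisymm (hle S hE) (hleast S' ((isEquilibrium_iff_consequence_eq M S').1 hS').le)
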